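/- Let p be analytic on 𝔻 with p(0) = 1 and let β ≥ e·Σ_{n=1}^∞ (−1)^{n+1}/(n!·n) (≈ 2.16538) be a real number. If the function z ↦ 1 + β·z·p'(z) is subordinate to e^z, then p(z) is subordinate to ℘(z) = 1 + z e^z. -/

import Mathlib

open Complex Metric

/-- `F` is subordinate to `G` on the unit disk `𝔻`. -/
def Subordinate (F G : ℂ → ℂ) : Prop :=
  ∃ ω : ℂ → ℂ, AnalyticOn ℂ ω (ball (0 : ℂ) 1) ∧ ω 0 = 0 ∧
    (∀ z ∈ ball (0 : ℂ) 1, ω z ∈ ball (0 : ℂ) 1) ∧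
    ∀ z ∈ ball (0 : ℂ) 1, F z = G (ω z)


lemma aux_re_exp {w : ℂ} {t : ℝ} (ht0 : 0 ≤ t) (ht : t ≤ 1) (hw : ‖w‖ ≤ t) :
    Real.exp (-t) ≤ (Complex.exp w).re := by
  have h1 : w.re ^ 2 + w.im ^ 2 ≤ t ^ 2 := by
    have := Complex.sq_norm w
    rw [Complex.normSq_apply] at this
    nlinarith [norm_nonneg w]
  have hx : -t ≤ w.re := by nlinarith [sq_nonneg w.im, abs_le_of_sq_le_sq' (a := w.re) (b := t) (by nlinarith [sq_nonneg w.im]) ht0]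
  set s := w.re + t with hs
  have hs0 : 0 ≤ s := by linarith
  have hc : 1 - s + s ^ 2 / 2 ≤ Real.cos w.im := by
    have := Real.one_sub_sq_div_two_le_cos (x := w.im)
    have : w.im ^ 2 ≤ 2 * s - s ^ 2 := by
      have : w.re = s - t := by linarith
      rw [this] at h1
      nlinarith
    linarith
  have he := Real.quadratic_le_exp_of_nonneg hs0
  have hm : 1 ≤ Real.exp s * Real.cos w.im := by
    have hp : 0 < 1 - s + s ^ 2 / 2 := by nlinarith [sq_nonneg (s - 1)]
    calc 1 ≤ (1 + s + s ^ 2 / 2) * (1 - s + s ^ 2 / 2) := by nlinarith [sq_nonneg (s ^ 2)]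
      _ ≤ _ := by gcongr
  rw [Complex.exp_re]
  have : Real.exp w.re = Real.exp (-t) * Real.exp s := by rw [← Real.exp_add]; congr 1; linarith
  rw [this, mul_assoc]
  nlinarith [Real.exp_pos (-t)]

lemma aux_bdry {v : ℂ} (hv : ‖v‖ = 1) (h1 : ‖v * Complex.exp v‖ < 1) :
    (v * Complex.exp v).re ≤ -Real.exp (-1) := by
  rw [norm_mul, hv, one_mul, Complex.norm_exp, Real.exp_lt_one_iff] at h1
  have h2 : v.re ^ 2 + v.im ^ 2 = 1 := by
    have := Complex.sq_norm v
    rw [Complex.normSq_apply, hv] at this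
    nlinarith
  have hsin : v.im ^ 2 - v.im ^ 4 / 6 ≤ v.im * Real.sin v.im := by
    rcases lt_trichotomy v.im 0 with h | h | h
    · have := Real.sin_gt_sub_cube (x := -v.im) (by linarith)
      rw [Real.sin_neg] at this
      nlinarith
    · simp [h]
    · have := Real.sin_gt_sub_cube h
      nlinarith
  have hcos := Real.one_sub_sq_div_two_le_cos (x := v.im)
  set s := 1 + v.re with hs
  have hre : v.re = s - 1 := by linarith
  have hs0 : 0 ≤ s := by nlinarith [sq_nonneg v.im]
  have hs1 : s ≤ 1 := by linarith
  have hy : v.im ^ 2 = 2 * s - s ^ 2 := by rw [hre] at h2; nlinarith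
  have hy4 : v.im ^ 4 = (2 * s - s ^ 2) ^ 2 := by rw [← hy]; ring
  have hm : 1 - s ^ 2 / 6 + s ^ 3 / 6 - s ^ 4 / 6 ≤ -v.re * Real.cos v.im + v.im * Real.sin v.im := by
    have : (1 - s) * (1 - v.im ^ 2 / 2) ≤ -v.re * Real.cos v.im := by
      rw [hre]; nlinarith
    rw [hy4] at hsin
    rw [hy] at hsin this
    nlinarith
  have hpos : 1 ≤ (1 + s) * (1 - s ^ 2 / 6 + s ^ 3 / 6 - s ^ 4 / 6) := by
    have a2 : s ^ 2 ≤ s := by nlinarith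
    have a3 : 0 ≤ s ^ 3 := by positivity
    have a4 : s ^ 4 ≤ s := by nlinarith [pow_le_one₀ hs0 hs1 (n := 3)]
    have a5 : s ^ 5 ≤ s := by nlinarith [pow_le_one₀ hs0 hs1 (n := 4)]
    have a33 : s ^ 3 ≤ s := by nlinarith
    nlinarith
  have he := Real.add_one_le_exp s
  have hf : 1 ≤ Real.exp s * (-v.re * Real.cos v.im + v.im * Real.sin v.im) := by
    have : 0 ≤ 1 - s ^ 2 / 6 + s ^ 3 / 6 - s ^ 4 / 6 := by
      by_contra hneg
      nlinarith
    calc 1 ≤ _ := hpos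
      _ ≤ _ := by gcongr; linarith
  have : Real.exp v.re = Real.exp (-1) * Real.exp s := by rw [← Real.exp_add]; congr 1; linarith
  rw [Complex.mul_re, Complex.exp_re, Complex.exp_im, this]
  nlinarith [Real.exp_pos (-1)]

lemma aux_sinh_le (a : ℝ) : Real.sinh a ^ 2 ≤ a ^ 2 * Real.cosh a ^ 2 := by
  have key : ∀ b : ℝ, 0 ≤ b → Real.sinh b ≤ b * Real.cosh b := by
    have hd : ∀ x : ℝ, HasDerivAt (fun b => b * Real.cosh b - Real.sinh b) (x * Real.sinh x) x := by
      intro x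
      have := ((hasDerivAt_id x).mul (Real.hasDerivAt_cosh x)).sub (Real.hasDerivAt_sinh x)
      exact this.congr_deriv (by simp)
    have hm : MonotoneOn (fun b => b * Real.cosh b - Real.sinh b) (Set.Ici 0) := by
      apply monotoneOn_of_deriv_nonneg (convex_Ici 0)
      · exact fun x _ => (hd x).continuousAt.continuousWithinAt
      · exact fun x _ => (hd x).differentiableAt.differentiableWithinAt
      · intro x hx
        rw [interior_Ici] at hx
        rw [(hd x).deriv]
        have hx' : 0 ≤ x := le_of_lt hx
        exact mul_nonneg hx' (Real.sinh_nonneg_iff.2 hx')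
    intro b hb
    have := hm (Set.mem_Ici.2 le_rfl) (Set.mem_Ici.2 hb) hb
    simp at this
    linarith
  rw [← mul_pow]
  rcases le_total 0 a with h | h
  · exact pow_le_pow_left₀ (Real.sinh_nonneg_iff.2 h) (key a h) 2
  · have := pow_le_pow_left₀ (Real.sinh_nonneg_iff.2 (neg_nonneg.2 h)) (key (-a) (by linarith)) 2
    simpa using this

lemma aux_sinh_cosh (x : ℂ) :
    ‖Complex.sinh x‖ ^ 2 ≤ ‖x‖ ^ 2 * (‖Complex.sinh x‖ ^ 2 + ‖Complex.cosh x‖ ^ 2) := by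
  obtain ⟨a, b, rfl⟩ : ∃ a b : ℝ, x = a + b * I := ⟨x.re, x.im, (Complex.re_add_im x).symm⟩
  have hs : ‖Complex.sinh (a + b * I)‖ ^ 2 = Real.sinh a ^ 2 + Real.sin b ^ 2 := by
    rw [Complex.sq_norm, Complex.sinh_add, Complex.sinh_mul_I, Complex.cosh_mul_I]
    rw [← Complex.ofReal_sinh, ← Complex.ofReal_cosh, ← Complex.ofReal_sin, ← Complex.ofReal_cos,
      ← mul_assoc, ← Complex.ofReal_mul, ← Complex.ofReal_mul, Complex.normSq_add_mul_I]
    nlinarith [Real.cosh_sq a, Real.sin_sq_add_cos_sq b]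
  have hc : ‖Complex.cosh (a + b * I)‖ ^ 2 = Real.cosh a ^ 2 - Real.sin b ^ 2 := by
    rw [Complex.sq_norm, Complex.cosh_add, Complex.sinh_mul_I, Complex.cosh_mul_I]
    rw [← Complex.ofReal_sinh, ← Complex.ofReal_cosh, ← Complex.ofReal_sin, ← Complex.ofReal_cos,
      ← mul_assoc, ← Complex.ofReal_mul, ← Complex.ofReal_mul, Complex.normSq_add_mul_I]
    nlinarith [Real.cosh_sq a, Real.sin_sq_add_cos_sq b]
  rw [hs, hc, Complex.sq_norm, Complex.normSq_add_mul_I]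
  have h1 := aux_sinh_le a
  have h2 : Real.sin b ^ 2 ≤ b ^ 2 := sq_le_sq.2 Real.abs_sin_le_abs
  have h3 := Real.cosh_sq a
  nlinarith [mul_nonneg (sq_nonneg a) (sq_nonneg (Real.sinh a)), mul_nonneg (sq_nonneg b) (sq_nonneg (Real.sinh a))]

lemma aux_inj {v w : ℂ} (hv : ‖v‖ < 1) (hw : ‖w‖ < 1)
    (h : v * Complex.exp v = w * Complex.exp w) : v = w := by
  set x := (v - w) / 2 with hx
  set m := (v + w) / 2 with hm
  have hvx : v = m + x := by rw [hx, hm]; ring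
  have hwx : w = m - x := by rw [hx, hm]; ring
  have h1 : (m + x) * Complex.exp x = (m - x) * Complex.exp (-x) := by
    have : Complex.exp m * ((m + x) * Complex.exp x) = Complex.exp m * ((m - x) * Complex.exp (-x)) := by
      have e1 : Complex.exp v = Complex.exp m * Complex.exp x := by rw [hvx, Complex.exp_add]
      have e2 : Complex.exp w = Complex.exp m * Complex.exp (-x) := by rw [hwx, sub_eq_add_neg, Complex.exp_add]
      rw [e1, e2] at h
      rw [← hvx, ← hwx]
      linear_combination h
    exact mul_left_cancel₀ (Complex.exp_ne_zero m) this
  have h2 : m * Complex.sinh x = -(x * Complex.cosh x) := by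
    rw [Complex.sinh, Complex.cosh]; linear_combination h1 / 2
  have h3 : ‖m‖ ^ 2 * ‖Complex.sinh x‖ ^ 2 = ‖x‖ ^ 2 * ‖Complex.cosh x‖ ^ 2 := by
    rw [← mul_pow, ← mul_pow, ← norm_mul, ← norm_mul, h2, norm_neg]
  have h4 : ‖m‖ ^ 2 + ‖x‖ ^ 2 < 1 := by
    have := parallelogram_law_with_norm ℝ m x
    rw [← hvx, ← hwx] at this
    nlinarith [norm_nonneg v, norm_nonneg w]
  have h5 := aux_sinh_cosh x
  have h6 : ‖Complex.sinh x‖ = 0 := by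
    by_contra hne
    have : 0 < ‖Complex.sinh x‖ ^ 2 := by positivity
    nlinarith
  have h7 : x = 0 := by
    by_contra hne
    have hxx : 0 < ‖x‖ ^ 2 := by positivity
    have : ‖Complex.cosh x‖ ^ 2 = 0 := by
      rw [h6] at h3
      have := h3.symm
      simpa [hne] using this
    have c0 : Complex.cosh x = 0 := by simpa using this
    have s0 : Complex.sinh x = 0 := by simpa using h6
    have := Complex.cosh_sq_sub_sinh_sq x
    rw [c0, s0] at this
    simp at this
  rw [hvx, hwx, h7]; simp

lemma aux_strict (v : ℂ) : HasStrictDerivAt (fun v : ℂ => v * Complex.exp v) ((1 + v) * Complex.exp v) v := by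
  have := (hasStrictDerivAt_id v).mul (Complex.hasStrictDerivAt_exp v)
  exact this.congr_deriv (by simp; ring)

lemma aux_ne {v : ℂ} (hv : ‖v‖ < 1) : (1 + v) * Complex.exp v ≠ 0 := by
  refine mul_ne_zero ?_ (Complex.exp_ne_zero v)
  intro h
  have : v = -1 := by linear_combination h
  rw [this] at hv
  simp at hv

lemma aux_surj {w : ℂ} (h1 : ‖w‖ < 1) (h2 : -Real.exp (-1) < w.re) :
    ∃ v : ℂ, ‖v‖ < 1 ∧ v * Complex.exp v = w := by
  set f : ℂ → ℂ := fun v => v * Complex.exp v with hf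
  have hcont : Continuous f := by fun_prop
  have hU : IsPreconnected (ball (0 : ℂ) 1 ∩ {w : ℂ | -Real.exp (-1) < w.re}) :=
    ((convex_ball _ _).inter (convex_halfSpace_re_gt _)).isPreconnected
  have hop : IsOpen (f '' ball 0 1) := by
    rw [isOpen_iff_mem_nhds]
    rintro _ ⟨v, hv, rfl⟩
    rw [← (aux_strict v).map_nhds_eq (aux_ne (by simpa using hv))]
    exact Filter.image_mem_map (isOpen_ball.mem_nhds hv)
  have hcl : IsOpen (f '' closedBall 0 1)ᶜ :=
    ((isCompact_closedBall (0 : ℂ) 1).image hcont).isClosed.isOpen_compl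
  have := hU.subset_left_of_subset_union hop hcl ?_ ?_ ?_
  · obtain ⟨v, hv, rfl⟩ := this ⟨by simpa using h1, h2⟩
    exact ⟨v, by simpa using hv, rfl⟩
  · rw [Set.disjoint_compl_right_iff_subset]
    exact Set.image_mono ball_subset_closedBall
  · rintro u ⟨hu1, hu2⟩
    by_cases hu : u ∈ f '' closedBall 0 1
    · left
      obtain ⟨v, hv, rfl⟩ := hu
      rcases lt_or_eq_of_le (show ‖v‖ ≤ 1 by simpa using hv) with h | h
      · exact ⟨v, by simpa using h, rfl⟩
      · have := aux_bdry h (by simpa [hf] using hu1)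
        exact absurd hu2 (not_lt.2 this)
    · right; exact hu
  · refine ⟨0, ⟨by simp, by simp [Real.exp_pos]⟩, 0, by simp, by simp [hf]⟩

lemma aux_lift (q : ℂ → ℂ) (hq : DifferentiableOn ℂ q (ball 0 1)) (hq0 : q 0 = 0)
    (h1 : ∀ z ∈ ball (0 : ℂ) 1, ‖q z‖ < 1) (h2 : ∀ z ∈ ball (0 : ℂ) 1, -Real.exp (-1) < (q z).re) :
    ∃ ω : ℂ → ℂ, AnalyticOn ℂ ω (ball (0 : ℂ) 1) ∧ ω 0 = 0 ∧
    (∀ z ∈ ball (0 : ℂ) 1, ω z ∈ ball (0 : ℂ) 1) ∧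
    ∀ z ∈ ball (0 : ℂ) 1, q z = ω z * Complex.exp (ω z) := by
  have : ∀ z : ℂ, ∃ v : ℂ, z ∈ ball (0 : ℂ) 1 → ‖v‖ < 1 ∧ v * Complex.exp v = q z := by
    intro z
    by_cases hz : z ∈ ball (0 : ℂ) 1
    · obtain ⟨v, hv⟩ := aux_surj (h1 z hz) (h2 z hz)
      exact ⟨v, fun _ => hv⟩
    · exact ⟨0, fun h => absurd h hz⟩
  choose ω hω using this
  refine ⟨ω, ?_, ?_, fun z hz => by simpa using (hω z hz).1, fun z hz => (hω z hz).2.symm⟩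
  · refine DifferentiableOn.analyticOn ?_ isOpen_ball
    intro z hz
    obtain ⟨hv, he⟩ := hω z hz
    have hst := aux_strict (ω z)
    have hne := aux_ne hv
    have hginv := hst.to_localInverse hne
    have hqd : DifferentiableAt ℂ q z := hq.differentiableAt (isOpen_ball.mem_nhds hz)
    set g := hst.localInverse _ _ _ hne with hg
    have hgz : g (ω z * Complex.exp (ω z)) = ω z :=
      (hst.hasStrictFDerivAt_equiv hne).localInverse_apply_image
    have hright := (hst.hasStrictFDerivAt_equiv hne).eventually_right_inverse
    have hgd : DifferentiableAt ℂ g (q z) := by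
      rw [← he]; exact hginv.hasDerivAt.differentiableAt
    have hcomp : DifferentiableAt ℂ (fun y => g (q y)) z := hgd.comp z hqd
    refine (hcomp.congr_of_eventuallyEq ?_).differentiableWithinAt
    have hmem : ∀ᶠ y in nhds z, g (q y) ∈ ball (0 : ℂ) 1 := by
      refine hcomp.continuousAt.eventually_mem (isOpen_ball.mem_nhds ?_)
      rw [← he, hgz]; simpa using hv
    have hr : ∀ᶠ y in nhds z, g (q y) * Complex.exp (g (q y)) = q y := by
      have : Filter.Tendsto q (nhds z) (nhds (ω z * Complex.exp (ω z))) := by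
        rw [he]; exact hqd.continuousAt
      exact this.eventually hright
    filter_upwards [hmem, hr, isOpen_ball.mem_nhds hz] with y hy1 hy2 hy3
    exact aux_inj (hω y hy3).1 (by simpa using hy1) ((hω y hy3).2.trans hy2.symm)
  · obtain ⟨hv, he⟩ := hω 0 (by simp)
    rw [hq0] at he
    simpa [Complex.exp_ne_zero] using he

lemma aux_summ : Summable (fun n : ℕ => 1 / ((Nat.factorial (n + 1) : ℝ))) := by
  have := (summable_nat_add_iff 1).2 (Real.summable_pow_div_factorial 1)
  simpa using this

lemma aux_hasSumK {t : ℝ} (ht : 0 < t) :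
    HasSum (fun n : ℕ => (-t) ^ n / (Nat.factorial (n + 1) : ℝ)) ((1 - Real.exp (-t)) / t) := by
  have h := NormedSpace.expSeries_div_hasSum_exp (𝔸 := ℝ) (-t)
  rw [← Real.exp_eq_exp_ℝ] at h
  have h2 := (hasSum_nat_add_iff' 1).2 h
  have h3 := h2.mul_left (-t)⁻¹
  have ht' : t ≠ 0 := ht.ne'
  convert! h3 using 1
  · funext n
    rw [pow_succ]; field_simp
  · simp; field_simp; ring

noncomputable def auxK (t : ℝ) : ℝ := ∑' n : ℕ, (-t) ^ n / (Nat.factorial (n + 1) : ℝ)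

lemma aux_termbound {t : ℝ} (ht : t ∈ Set.Icc (0 : ℝ) 1) (n : ℕ) :
    ‖(-t) ^ n / (Nat.factorial (n + 1) : ℝ)‖ ≤ 1 / (Nat.factorial (n + 1) : ℝ) := by
  rw [norm_div, norm_pow, norm_neg, Real.norm_of_nonneg ht.1, Real.norm_natCast]
  gcongr
  exact pow_le_one₀ ht.1 ht.2

lemma auxK_cont : ContinuousOn auxK (Set.Icc 0 1) :=
  continuousOn_tsum (fun n => by fun_prop) aux_summ (fun n t ht => aux_termbound ht n)

lemma auxK_integral : HasSum (fun n : ℕ => (-1 : ℝ) ^ (n + 2) / ((Nat.factorial (n + 1) : ℝ) * ((n : ℝ) + 1)))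
    (∫ t in (0 : ℝ)..1, auxK t) := by
  have h := intervalIntegral.hasSum_integral_of_dominated_convergence
    (μ := MeasureTheory.volume) (a := (0 : ℝ)) (b := 1)
    (F := fun (n : ℕ) (t : ℝ) => (-t) ^ n / (Nat.factorial (n + 1) : ℝ)) (f := auxK)
    (fun n _ => 1 / ((Nat.factorial (n + 1) : ℝ))) ?_ ?_ ?_ ?_ ?_
  · convert! h using 1
    funext n
    have : ∀ t : ℝ, (-t) ^ n / (Nat.factorial (n + 1) : ℝ) =
        ((-1) ^ n / (Nat.factorial (n + 1) : ℝ)) * t ^ n := by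
      intro t; rw [neg_pow]; ring
    rw [intervalIntegral.integral_congr (fun t _ => this t), intervalIntegral.integral_const_mul, integral_pow]
    simp
    field_simp
    ring
  · intro n
    exact (by fun_prop : Continuous fun t : ℝ => (-t) ^ n / (Nat.factorial (n + 1) : ℝ)).aestronglyMeasurable
  · intro n
    refine Filter.Eventually.of_forall fun t ht => ?_
    rw [Set.uIoc_of_le zero_le_one] at ht
    exact aux_termbound ⟨ht.1.le, ht.2⟩ n
  · exact Filter.Eventually.of_forall fun t _ => aux_summ
  · simp
  · refine Filter.Eventually.of_forall fun t ht => ?_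
    rw [Set.uIoc_of_le zero_le_one] at ht
    exact (aux_hasSumK ht.1).summable.hasSum

lemma aux_S_ge : (3 : ℝ) / 4 ≤ ∫ t in (0 : ℝ)..1, auxK t := by
  have h := auxK_integral.tendsto_sum_nat
  have h2 := Antitone.alternating_series_le_tendsto
    (f := fun n : ℕ => 1 / ((Nat.factorial (n + 1) : ℝ) * ((n : ℝ) + 1))) (l := ∫ t in (0 : ℝ)..1, auxK t) ?_ ?_ 1
  · simp [Finset.sum_range_succ] at h2
    norm_num at h2
    linarith
  · convert! h using 3
    rw [pow_add]; ring
  · apply antitone_nat_of_succ_le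
    intro n
    have : (Nat.factorial (n + 1) : ℝ) ≤ (Nat.factorial (n + 1 + 1) : ℝ) := by
      exact_mod_cast Nat.factorial_le (by omega)
    have h0 : (0 : ℝ) < (Nat.factorial (n + 1) : ℝ) := by positivity
    push_cast
    gcongr
    linarith

/-- if `β ≥ e·Σ_{n≥1} (−1)^{n+1}/(n!·n)` and `1 + β·z·p'(z) ≺ e^z`,
then `p ≺ 1 + z e^z`. -/
theorem stmt_17 (p : ℂ → ℂ) (hp : AnalyticOn ℂ p (ball (0 : ℂ) 1)) (hp0 : p 0 = 1)
    (β : ℝ)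
    (hβ : Real.exp 1 *
      (∑' n : ℕ, (-1 : ℝ) ^ (n + 2) / ((Nat.factorial (n + 1) : ℝ) * ((n : ℝ) + 1))) ≤ β)
    (hsub : Subordinate (fun z => 1 + (β : ℂ) * z * deriv p z)
      (fun z => Complex.exp z)) :
    Subordinate p (fun z => 1 + z * Complex.exp z) := by
  rw [auxK_integral.tsum_eq] at hβ
  have hS := aux_S_ge
  have hβ2 : 2 < β := by nlinarith [Real.exp_one_gt_d9]
  obtain ⟨ω, hωa, hω0, hωm, hωe⟩ := hsub
  have hpN : AnalyticOnNhd ℂ p (ball 0 1) := isOpen_ball.analyticOn_iff_analyticOnNhd.1 hp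
  have hschw : ∀ z ∈ ball (0 : ℂ) 1, ‖ω z‖ ≤ ‖z‖ := fun z hz =>
    Complex.norm_le_norm_of_mapsTo_ball hωa.differentiableOn
      (fun y hy => ball_subset_closedBall (hωm y hy)) hω0 (by simpa using hz)
  have hmemt : ∀ z ∈ ball (0 : ℂ) 1, ∀ t ∈ Set.Icc (0 : ℝ) 1, (t : ℂ) * z ∈ ball (0 : ℂ) 1 := by
    intro z hz t ht
    rw [mem_ball_zero_iff] at hz ⊢
    rw [norm_mul, Complex.norm_real, Real.norm_of_nonneg ht.1]
    nlinarith [ht.1, ht.2, norm_nonneg z]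
  have hder : ∀ z ∈ ball (0 : ℂ) 1, ∀ t ∈ Set.Icc (0 : ℝ) 1,
      HasDerivAt (fun t : ℝ => p (t * z)) (z * deriv p (t * z)) t := by
    intro z hz t ht
    have h1 : HasDerivAt p (deriv p (t * z)) (t * z) :=
      (hpN _ (hmemt z hz t ht)).differentiableAt.hasDerivAt
    have h2 : HasDerivAt (fun t : ℝ => (t : ℂ) * z) z t := by
      simpa using (Complex.ofRealCLM.hasDerivAt (x := t)).mul_const z
    have := h1.scomp t h2
    simpa [Function.comp_def] using this
  have hcontD : ∀ z ∈ ball (0 : ℂ) 1,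
      ContinuousOn (fun t : ℝ => z * deriv p (t * z)) (Set.Icc 0 1) := by
    intro z hz
    refine continuousOn_const.mul ?_
    refine (hpN.deriv.continuousOn).comp (by fun_prop) (fun t ht => hmemt z hz t ht)
  have hkey : ∀ z ∈ ball (0 : ℂ) 1, ∀ t ∈ Set.Icc (0 : ℝ) 1,
      (t : ℂ) * β * (z * deriv p (t * z)) = Complex.exp (ω (t * z)) - 1 := by
    intro z hz t ht
    have := hωe _ (hmemt z hz t ht)
    simp only at this
    rw [← this]; ring
  have hωt : ∀ z ∈ ball (0 : ℂ) 1, ∀ t ∈ Set.Icc (0 : ℝ) 1, ‖ω (t * z)‖ ≤ t * ‖z‖ := by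
    intro z hz t ht
    refine (hschw _ (hmemt z hz t ht)).trans_eq ?_
    rw [norm_mul, Complex.norm_real, Real.norm_of_nonneg ht.1]
  have hnorm : ∀ z ∈ ball (0 : ℂ) 1, ‖p z - 1‖ < 1 := by
    intro z hz
    have hz' : ‖z‖ < 1 := by simpa using hz
    have hI := intervalIntegral.integral_eq_sub_of_hasDerivAt (a := (0 : ℝ)) (b := 1)
      (f := fun t : ℝ => p (t * z)) (f' := fun t : ℝ => z * deriv p (t * z))
      (fun t ht => hder z hz t (by rwa [Set.uIcc_of_le zero_le_one] at ht))
      ((hcontD z hz).intervalIntegrable_of_Icc zero_le_one)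
    simp only [ofReal_one, one_mul, ofReal_zero, zero_mul, hp0] at hI
    rw [← hI]
    have hb := intervalIntegral.norm_integral_le_of_norm_le_const (a := (0 : ℝ)) (b := 1)
      (f := fun t : ℝ => z * deriv p (t * z)) (C := ‖z‖) ?_
    · rw [sub_zero, abs_one, mul_one] at hb
      exact hb.trans_lt hz'
    · intro t ht
      rw [Set.uIoc_of_le zero_le_one] at ht
      have ht' : t ∈ Set.Icc (0 : ℝ) 1 := ⟨ht.1.le, ht.2⟩
      have hw := hωt z hz t ht'
      have h1 : ‖Complex.exp (ω (t * z)) - 1‖ ≤ 2 * ‖ω (t * z)‖ :=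
        Complex.norm_exp_sub_one_le (by have := hωm _ (hmemt z hz t ht'); rw [mem_ball_zero_iff] at this; exact this.le)
      rw [← hkey z hz t ht', norm_mul, norm_mul, Complex.norm_real, Complex.norm_real,
        Real.norm_of_nonneg ht'.1, Real.norm_of_nonneg (by linarith)] at h1
      have h2 : t * (β * ‖z * deriv p (t * z)‖) ≤ t * (2 * ‖z‖) := by linarith
      have h3 := le_of_mul_le_mul_left h2 ht.1
      nlinarith [norm_nonneg (z * deriv p (t * z))]
  have hre : ∀ z ∈ ball (0 : ℂ) 1, -Real.exp (-1) < (p z - 1).re := by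
    intro z hz
    have hz' : ‖z‖ < 1 := by simpa using hz
    have hcr : ContinuousOn (fun t : ℝ => (z * deriv p (t * z)).re) (Set.Icc 0 1) :=
      Complex.continuous_re.comp_continuousOn (hcontD z hz)
    have hI := intervalIntegral.integral_eq_sub_of_hasDerivAt (a := (0 : ℝ)) (b := 1)
      (f := fun t : ℝ => (p (t * z)).re) (f' := fun t : ℝ => (z * deriv p (t * z)).re)
      (fun t ht => by
        have h := hder z hz t (by rwa [Set.uIcc_of_le zero_le_one] at ht)
        exact (Complex.reCLM.hasFDerivAt.comp_hasDerivAt t h))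
      (hcr.intervalIntegrable_of_Icc zero_le_one)
    simp only [ofReal_one, one_mul, ofReal_zero, zero_mul, hp0, one_re] at hI
    have hrel : ∀ t ∈ Set.Ioc (0 : ℝ) 1,
        t * (β * (z * deriv p (t * z)).re) ≥ Real.exp (-(t * ‖z‖)) - 1 := by
      intro t ht
      have ht' : t ∈ Set.Icc (0 : ℝ) 1 := ⟨ht.1.le, ht.2⟩
      have h1 := aux_re_exp (t := t * ‖z‖) (mul_nonneg ht'.1 (norm_nonneg z))
        (by nlinarith [ht.1, ht.2, norm_nonneg z]) (hωt z hz t ht')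
      have h2 := congrArg Complex.re (hkey z hz t ht')
      rw [← Complex.ofReal_mul, Complex.re_ofReal_mul, Complex.sub_re, Complex.one_re] at h2
      linarith
    have hKt : ∀ t ∈ Set.Ioc (0 : ℝ) 1, t * auxK t = 1 - Real.exp (-t) := by
      intro t ht
      rw [auxK, (aux_hasSumK ht.1).tsum_eq]
      have := ht.1.ne'
      field_simp
    have hlt := intervalIntegral.integral_lt_integral_of_continuousOn_of_le_of_exists_lt
      (a := (0 : ℝ)) (b := 1) (f := fun t => -auxK t) (g := fun t : ℝ => β * (z * deriv p (t * z)).re)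
      one_pos auxK_cont.neg (continuousOn_const.mul hcr) ?_ ?_
    · rw [intervalIntegral.integral_neg, intervalIntegral.integral_const_mul, hI] at hlt
      rw [Complex.sub_re, Complex.one_re]
      set S := ∫ t in (0 : ℝ)..1, auxK t
      have hee : Real.exp 1 * Real.exp (-1) = 1 := by rw [← Real.exp_add]; simp
      have : S ≤ β * Real.exp (-1) := by
        nlinarith [Real.exp_pos (-1)]
      nlinarith
    · intro t ht
      have h1 := hrel t ht
      have h2 := hKt t ht
      have h3 : Real.exp (-t) ≤ Real.exp (-(t * ‖z‖)) := by
        apply Real.exp_le_exp.2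
        nlinarith [ht.1]
      refine le_of_mul_le_mul_left ?_ ht.1
      linarith
    · refine ⟨1, by simp, ?_⟩
      have h1 := hrel 1 (by simp)
      have h2 := hKt 1 (by simp)
      have h3 : Real.exp (-1) < Real.exp (-(1 * ‖z‖)) := by
        apply Real.exp_lt_exp.2
        linarith
      linarith
  obtain ⟨v, hv1, hv2, hv3, hv4⟩ := aux_lift (fun z => p z - 1) (hp.differentiableOn.sub_const 1)
    (by simp [hp0]) hnorm hre
  refine ⟨v, hv1, hv2, hv3, fun z hz => ?_⟩
  have := hv4 z hz
  simp only at this ⊢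
  rw [← this]; ring
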